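/- arXiv:1510.00178 — 7 statements merged into one kernel-verified Lean document; each statement's English description precedes it below -/
import Mathlib

section
/- Assume δ̃ > 0. Then for all real numbers x₃ with 0 < x₃ < 1 and x₄ > 0, if x₄ < x₃^{e24/e23} then x₄·x₃^{ν̃} < (x₃^{ρ̃})^{e24/e23}. (Lemma 4.2 for the R-cycle: if δ̃ > 0 then every point that takes one turn around the R-cycle takes a second turn, i.e. Ẽ₁ = Ẽ₂.) -/
/-- Lemma 4.2 for the R-cycle of the Bowtie network: if `δ̃ > 0`, then every
point that takes one turn around the R-cycle (i.e. `x₄ < x₃^{e24/e23}`) takes a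
second turn (its image under the return map satisfies the same condition). -/
theorem stmt_10 (c21 c25 c32 c34 c35 c13 c14 c15 e12 e23 e24 e31 : ℝ)
    (hc21 : 0 < c21) (hc25 : 0 < c25) (hc32 : 0 < c32) (hc34 : 0 < c34)
    (hc35 : 0 < c35) (hc13 : 0 < c13) (hc14 : 0 < c14) (hc15 : 0 < c15)
    (he12 : 0 < e12) (he23 : 0 < e23) (he24 : 0 < e24) (he31 : 0 < e31)
    (ρt νt δt : ℝ)
    (hρt : ρt = c32 * c13 * c21 / (e23 * e31 * e12))
    (hνt : νt = -(e24 / e23) + c21 * c34 / (e23 * e31) + c14 * c32 * c21 / (e31 * e23 * e12))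
    (hδt : δt = c34 / e31 + c14 * c32 / (e12 * e31) - e24 * c13 * c32 / (e12 * e31 * e23))
    (hδ : 0 < δt)
    (x3 x4 : ℝ) (hx3 : 0 < x3) (hx3' : x3 < 1) (hx4 : 0 < x4)
    (hin : x4 < x3 ^ (e24 / e23)) :
    x4 * x3 ^ νt < (x3 ^ ρt) ^ (e24 / e23) := by
  have key : e24 / e23 + νt = ρt * (e24 / e23) + c21 / e23 * δt := by
    rw [hρt, hνt, hδt]
    field_simp
    ring
  have hpos : 0 < c21 / e23 * δt := by positivity
  calc x4 * x3 ^ νt < x3 ^ (e24 / e23) * x3 ^ νt :=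
        mul_lt_mul_of_pos_right hin (Real.rpow_pos_of_pos hx3 _)
    _ = x3 ^ (e24 / e23 + νt) := (Real.rpow_add hx3 _ _).symm
    _ < x3 ^ (ρt * (e24 / e23)) :=
        Real.rpow_lt_rpow_of_exponent_gt hx3 hx3' (by linarith)
    _ = (x3 ^ ρt) ^ (e24 / e23) := Real.rpow_mul hx3.le _ _
end

section
/- Define the sequence a : ℕ → ℝ by a_n = (e24/e23)·ρ̃ⁿ − ν̃·Σ_{i=0}^{n−1} ρ̃^i. Then for every n ≥ 1, a_{n+1} − a_n = −(c21/e23)·δ̃·ρ̃ⁿ; in particular, if δ̃ < 0 then the sequence (a_n)_{n≥1} is strictly increasing. (First part of Proposition 4.3.) -/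
/-- First part of Proposition 4.3: for `a_n = (e24/e23)·ρ̃ⁿ − ν̃·Σ_{i<n} ρ̃ⁱ` one has
`a_{n+1} − a_n = −(c21/e23)·δ̃·ρ̃ⁿ` for every `n ≥ 1`; in particular, if `δ̃ < 0`
then `(a_n)_{n≥1}` is strictly increasing. -/
theorem stmt_11 (c21 c25 c32 c34 c35 c13 c14 c15 e12 e23 e24 e31 : ℝ)
    (hc21 : 0 < c21) (hc25 : 0 < c25) (hc32 : 0 < c32) (hc34 : 0 < c34)
    (hc35 : 0 < c35) (hc13 : 0 < c13) (hc14 : 0 < c14) (hc15 : 0 < c15)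
    (he12 : 0 < e12) (he23 : 0 < e23) (he24 : 0 < e24) (he31 : 0 < e31)
    (ρt νt δt : ℝ)
    (hρt : ρt = c32 * c13 * c21 / (e23 * e31 * e12))
    (hνt : νt = -(e24 / e23) + c21 * c34 / (e23 * e31) + c14 * c32 * c21 / (e31 * e23 * e12))
    (hδt : δt = c34 / e31 + c14 * c32 / (e12 * e31) - e24 * c13 * c32 / (e12 * e31 * e23))
    (a : ℕ → ℝ)
    (ha : ∀ n, a n = (e24 / e23) * ρt ^ n - νt * ∑ i ∈ Finset.range n, ρt ^ i) :
    (∀ n, 1 ≤ n → a (n + 1) - a n = -(c21 / e23) * δt * ρt ^ n) ∧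
    (δt < 0 → ∀ m n, 1 ≤ m → m < n → a m < a n) := by
  have key : (e24 / e23) * (ρt - 1) - νt = -(c21 / e23) * δt := by
    rw [hρt, hνt, hδt]
    field_simp
    ring
  have step : ∀ n, a (n + 1) - a n = -(c21 / e23) * δt * ρt ^ n := by
    intro n
    rw [ha, ha, Finset.sum_range_succ, ← key]
    ring
  refine ⟨fun n _ => step n, fun hδ m n _ hmn => ?_⟩
  have hρ : 0 < ρt := by
    rw [hρt]
    positivity
  have hmono : StrictMono a := by
    refine strictMono_nat_of_lt_succ fun k => ?_
    have h1 : 0 < (c21 / e23) * (-δt) * ρt ^ k :=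
      mul_pos (mul_pos (div_pos hc21 he23) (neg_pos.mpr hδ)) (pow_pos hρ k)
    have h2 := step k
    linarith
  exact hmono hmn
end

section
/- Assume δ̃ < 0 and define a_n = (e24/e23)·ρ̃ⁿ − ν̃·Σ_{i=0}^{n−1} ρ̃^i. Then for every n ≥ 1 the set Ẽ_{n+1} = {(x₃,x₄) ∈ (0,1)×(0,∞) : x₄ < x₃^{a_n}} is a proper subset of Ẽ_n = {(x₃,x₄) ∈ (0,1)×(0,∞) : x₄ < x₃^{a_{n−1}}}. (Proper nestedness Ẽ_{n+1} ⊊ Ẽ_n from Proposition 4.3.) -/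
/-- Proper nestedness `Ẽ_{n+1} ⊊ Ẽ_n` from Proposition 4.3: if `δ̃ < 0` then for
every `n ≥ 1`, `{(x₃,x₄) ∈ (0,1)×(0,∞) : x₄ < x₃^{a_n}}` is a proper subset of
`{(x₃,x₄) ∈ (0,1)×(0,∞) : x₄ < x₃^{a_{n−1}}}`. -/
theorem stmt_12 (c21 c25 c32 c34 c35 c13 c14 c15 e12 e23 e24 e31 : ℝ)
    (hc21 : 0 < c21) (hc25 : 0 < c25) (hc32 : 0 < c32) (hc34 : 0 < c34)
    (hc35 : 0 < c35) (hc13 : 0 < c13) (hc14 : 0 < c14) (hc15 : 0 < c15)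
    (he12 : 0 < e12) (he23 : 0 < e23) (he24 : 0 < e24) (he31 : 0 < e31)
    (ρt νt δt : ℝ)
    (hρt : ρt = c32 * c13 * c21 / (e23 * e31 * e12))
    (hνt : νt = -(e24 / e23) + c21 * c34 / (e23 * e31) + c14 * c32 * c21 / (e31 * e23 * e12))
    (hδt : δt = c34 / e31 + c14 * c32 / (e12 * e31) - e24 * c13 * c32 / (e12 * e31 * e23))
    (hδ : δt < 0)
    (a : ℕ → ℝ)
    (ha : ∀ n, a n = (e24 / e23) * ρt ^ n - νt * ∑ i ∈ Finset.range n, ρt ^ i)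
    (n : ℕ) (hn : 1 ≤ n) :
    {z : ℝ × ℝ | z.1 ∈ Set.Ioo (0 : ℝ) 1 ∧ 0 < z.2 ∧ z.2 < z.1 ^ a n} ⊂
    {z : ℝ × ℝ | z.1 ∈ Set.Ioo (0 : ℝ) 1 ∧ 0 < z.2 ∧ z.2 < z.1 ^ a (n - 1)} := by
  obtain ⟨m, rfl⟩ : ∃ m, n = m + 1 := ⟨n - 1, by omega⟩
  rw [Nat.add_sub_cancel]
  have hρ : 0 < ρt := by rw [hρt]; positivity
  have hdiff : a (m + 1) - a m = ρt ^ m * (c21 / e23 * (-δt)) := by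
    have key : (e24 / e23) * ρt - e24 / e23 - νt = c21 / e23 * (-δt) := by
      rw [hρt, hνt, hδt]
      field_simp
      ring
    rw [ha, ha, Finset.sum_range_succ, ← key]
    ring
  have hpos : 0 < ρt ^ m * (c21 / e23 * (-δt)) := by
    have : 0 < -δt := by linarith
    positivity
  have hlt : a m < a (m + 1) := by linarith
  have hpow : ∀ x : ℝ, 0 < x → x < 1 → x ^ a (m + 1) < x ^ a m := fun x h0 h1 =>
    Real.rpow_lt_rpow_of_exponent_gt h0 h1 hlt
  rw [Set.ssubset_iff_of_subset]
  · refine ⟨((1 / 2 : ℝ), (1 / 2 : ℝ) ^ a (m + 1)), ⟨⟨by norm_num, by norm_num⟩, ?_, ?_⟩, ?_⟩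
    · exact Real.rpow_pos_of_pos (by norm_num) _
    · exact hpow _ (by norm_num) (by norm_num)
    · rintro ⟨_, _, h⟩
      exact lt_irrefl _ h
  · rintro z ⟨hz, h0, h1⟩
    exact ⟨hz, h0, h1.trans (hpow _ hz.1 hz.2)⟩
end

section
/- Assume δ̃ < 0 and ρ̃ ≥ 1, and define a_n = (e24/e23)·ρ̃ⁿ − ν̃·Σ_{i=0}^{n−1} ρ̃^i. Then a_n → ∞ as n → ∞, and consequently for every x₃ with 0 < x₃ < 1 and every x₄ > 0 there exists n ∈ ℕ with x₄ ≥ x₃^{a_n}. (Second part of Proposition 4.3 / Theorem 4.4: every point takes only finitely many consecutive turns around the R-cycle, so no trajectory is asymptotic to the R-cycle alone.) -/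
/-- Second part of Proposition 4.3 / Theorem 4.4: if `δ̃ < 0` and `ρ̃ ≥ 1`, the
exponents `a_n = (e24/e23)·ρ̃ⁿ − ν̃·Σ_{i<n} ρ̃ⁱ` tend to infinity; consequently
every point `(x₃,x₄)` with `0 < x₃ < 1`, `x₄ > 0` takes only finitely many
consecutive turns around the R-cycle: there is `n` with `x₄ ≥ x₃^{a_n}`. -/
theorem stmt_13 (c21 c25 c32 c34 c35 c13 c14 c15 e12 e23 e24 e31 : ℝ)
    (hc21 : 0 < c21) (hc25 : 0 < c25) (hc32 : 0 < c32) (hc34 : 0 < c34)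
    (hc35 : 0 < c35) (hc13 : 0 < c13) (hc14 : 0 < c14) (hc15 : 0 < c15)
    (he12 : 0 < e12) (he23 : 0 < e23) (he24 : 0 < e24) (he31 : 0 < e31)
    (ρt νt δt : ℝ)
    (hρt : ρt = c32 * c13 * c21 / (e23 * e31 * e12))
    (hνt : νt = -(e24 / e23) + c21 * c34 / (e23 * e31) + c14 * c32 * c21 / (e31 * e23 * e12))
    (hδt : δt = c34 / e31 + c14 * c32 / (e12 * e31) - e24 * c13 * c32 / (e12 * e31 * e23))
    (hδ : δt < 0) (hρ1 : 1 ≤ ρt)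
    (a : ℕ → ℝ)
    (ha : ∀ n, a n = (e24 / e23) * ρt ^ n - νt * ∑ i ∈ Finset.range n, ρt ^ i) :
    Filter.Tendsto a Filter.atTop Filter.atTop ∧
    ∀ x3 x4 : ℝ, 0 < x3 → x3 < 1 → 0 < x4 → ∃ n : ℕ, x3 ^ a n ≤ x4 := by
  have hν : νt = (e24 / e23) * (ρt - 1) + δt * (c21 / e23) := by
    rw [hνt, hδt, hρt]
    field_simp
    ring
  have hpos : 0 < -δt * (c21 / e23) := mul_pos (neg_pos.mpr hδ) (div_pos hc21 he23)
  have hform : ∀ n, a n = e24 / e23 + (-δt * (c21 / e23)) * ∑ i ∈ Finset.range n, ρt ^ i := by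
    intro n
    rw [ha n, hν]
    have hg := geom_sum_mul ρt n
    linear_combination (-(e24 / e23)) * hg
  have hS : ∀ n : ℕ, (n : ℝ) ≤ ∑ i ∈ Finset.range n, ρt ^ i := by
    intro n
    have h := Finset.sum_le_sum (s := Finset.range n) (f := fun _ => (1 : ℝ))
      (g := fun i => ρt ^ i) (fun i _ => one_le_pow₀ hρ1)
    simpa using h
  have ht : Filter.Tendsto a Filter.atTop Filter.atTop := by
    have h1 : Filter.Tendsto (fun n : ℕ => ∑ i ∈ Finset.range n, ρt ^ i)
        Filter.atTop Filter.atTop :=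
      Filter.tendsto_atTop_mono hS tendsto_natCast_atTop_atTop
    rw [show a = _ from funext hform]
    exact Filter.tendsto_atTop_add_const_left _ _ (h1.const_mul_atTop hpos)
  refine ⟨ht, ?_⟩
  intro x3 x4 h0 h1 h4
  have h2 := (tendsto_rpow_atTop_of_base_lt_one x3 (by linarith) h1).comp ht
  obtain ⟨n, hn⟩ := (h2.eventually (gt_mem_nhds h4)).exists
  exact ⟨n, le_of_lt hn⟩
end

section
/- Assume δ < 0 and e23 > e24. Then for every ε with 0 < ε < 1: (i) there exist x₃, x₄, x₅ ∈ (0,ε) with x₄ > x₃^{e24/e23} and x₄^{(e23/e24)·ρ − ν} · x₅^{(e23/c25)·ρ − β} < x₃; and (ii) there exist x₃, x₄, x₅ ∈ (0,ε) with x₄ > x₃^{e24/e23} and x₄^{(e23/e24)·ρ − ν} · x₅^{(e23/c25)·ρ − β} > x₃. (Proposition 4.5: there are points near the R-cycle that visit the L-cycle and immediately return to the R-cycle (sequence RLR), and points that visit the L-cycle and stay for at least one turn (sequence RLL).) -/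
theorem exists_small_rpow (p y ε : ℝ) (hp : 0 < p) (hy : 0 < y) (hε : 0 < ε) :
    ∃ x : ℝ, 0 < x ∧ x < ε ∧ x ^ p < y := by
  refine ⟨min (ε / 2) ((y / 2) ^ (1 / p)), by positivity, ?_, ?_⟩
  · exact lt_of_le_of_lt (min_le_left _ _) (by linarith)
  · have h : (min (ε / 2) ((y / 2) ^ (1 / p))) ^ p ≤ ((y / 2) ^ (1 / p)) ^ p :=
      Real.rpow_le_rpow (by positivity) (min_le_right _ _) hp.le
    rw [← Real.rpow_mul (by positivity), one_div_mul_cancel hp.ne', Real.rpow_one] at h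
    linarith

/-- Proposition 4.5 for the Bowtie network: if `δ < 0` and `e23 > e24`, then in
every neighbourhood `(0,ε)³` there are points leaving the R-cycle
(`x₄ > x₃^{e24/e23}`) whose image under `g_{RL}` immediately returns to the
R-cycle (sequence `RLR`), and points whose image stays near the L-cycle for at
least one turn (sequence `RLL`). -/
theorem stmt_15 (c21 c25 c41 c42 c43 c51 c53 c54 e23 e24 e45 e52 : ℝ)
    (hc21 : 0 < c21) (hc25 : 0 < c25) (hc41 : 0 < c41) (hc42 : 0 < c42)
    (hc43 : 0 < c43) (hc51 : 0 < c51) (hc53 : 0 < c53) (hc54 : 0 < c54)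
    (he23 : 0 < e23) (he24 : 0 < e24) (he45 : 0 < e45) (he52 : 0 < e52)
    (ρ ν δ β : ℝ)
    (hρ : ρ = c42 * c54 * c25 / (e24 * e45 * e52))
    (hν : ν = -(e23 / e24) + c25 * c43 / (e24 * e45) + c53 * c42 * c25 / (e45 * e24 * e52))
    (hδ : δ = c43 / e45 + c53 * c42 / (e52 * e45) - e23 * c54 * c42 / (e52 * e45 * e24))
    (hβ : β = c43 / e45 + c42 * c53 / (e45 * e52))
    (hδneg : δ < 0) (he : e23 > e24)
    (ε : ℝ) (hε0 : 0 < ε) (hε1 : ε < 1) :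
    (∃ x3 x4 x5 : ℝ, x3 ∈ Set.Ioo 0 ε ∧ x4 ∈ Set.Ioo 0 ε ∧ x5 ∈ Set.Ioo 0 ε ∧
      x4 > x3 ^ (e24 / e23) ∧
      x4 ^ ((e23 / e24) * ρ - ν) * x5 ^ ((e23 / c25) * ρ - β) < x3) ∧
    (∃ x3 x4 x5 : ℝ, x3 ∈ Set.Ioo 0 ε ∧ x4 ∈ Set.Ioo 0 ε ∧ x5 ∈ Set.Ioo 0 ε ∧
      x4 > x3 ^ (e24 / e23) ∧
      x4 ^ ((e23 / e24) * ρ - ν) * x5 ^ ((e23 / c25) * ρ - β) > x3) := by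
  have hb : (e23 / c25) * ρ - β = -δ := by
    rw [hρ, hβ, hδ]; field_simp; ring
  have hb0 : 0 < -δ := by linarith
  have hs : 0 < e24 / e23 := by positivity
  rw [hb]
  have hx : 0 < ε / 2 := by positivity
  have hxε : ε / 2 < ε := by linarith
  generalize (e23 / e24) * ρ - ν = a
  constructor
  · obtain ⟨x3, h0, h1, h2⟩ := exists_small_rpow (e24 / e23) (ε / 2) ε hs hx hε0
    have hA : 0 < (ε / 2) ^ a := by positivity
    obtain ⟨x5, k0, k1, k2⟩ := exists_small_rpow (-δ) (x3 / (ε / 2) ^ a) ε hb0 (by positivity) hε0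
    refine ⟨x3, ε / 2, x5, ⟨h0, h1⟩, ⟨hx, hxε⟩, ⟨k0, k1⟩, h2, ?_⟩
    rw [lt_div_iff₀ hA] at k2
    linarith
  · have hK : 0 < (ε / 2) ^ a * (ε / 2) ^ (-δ) := by positivity
    obtain ⟨x3, h0, h1, h2⟩ := exists_small_rpow (e24 / e23) (ε / 2)
      (min ε ((ε / 2) ^ a * (ε / 2) ^ (-δ))) hs hx (lt_min hε0 hK)
    exact ⟨x3, ε / 2, ε / 2, ⟨h0, h1.trans_le (min_le_left _ _)⟩, ⟨hx, hxε⟩, ⟨hx, hxε⟩, h2,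
      h1.trans_le (min_le_right _ _)⟩
end

section
/- Let c32, c34, c35, e31 be positive real numbers and α > 0, and define φ : (0,∞)×ℝ×(0,∞) → (0,∞)×ℝ×(0,∞) by φ(x₁,x₄,x₅) = (x₁^{c32/e31}, x₄·x₁^{c34/e31}, x₅·x₁^{c35/e31}). Then φ maps the curve {(t, 0, t^{α}) : t ∈ (0,1)} bijectively onto the curve {(s, 0, s^{β'}) : s ∈ (0,1)} with β' = (α·e31 + c35)/c32. (Core computation of Lemma 4.1: the local map φ₂₃₁ sends a cusp in the x₁x₅-plane to a cusp in the x₂x₅-plane, establishing switching along each cycle of the Bowtie network.) -/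
/-- Core computation of Lemma 4.1: the local map `φ₂₃₁` of the Bowtie network,
`(x₁,x₄,x₅) ↦ (x₁^{c32/e31}, x₄·x₁^{c34/e31}, x₅·x₁^{c35/e31})`, maps the cusp
curve `{(t,0,t^α) : t ∈ (0,1)}` bijectively onto the cusp curve
`{(s,0,s^{β'}) : s ∈ (0,1)}` with `β' = (α·e31 + c35)/c32`. -/
theorem stmt_17 (c32 c34 c35 e31 α : ℝ)
    (hc32 : 0 < c32) (hc34 : 0 < c34) (hc35 : 0 < c35) (he31 : 0 < e31) (hα : 0 < α)
    (φ : ℝ × ℝ × ℝ → ℝ × ℝ × ℝ)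
    (hφ : ∀ x1 x4 x5 : ℝ,
      φ (x1, x4, x5) = (x1 ^ (c32 / e31), x4 * x1 ^ (c34 / e31), x5 * x1 ^ (c35 / e31))) :
    Set.BijOn φ
      ((fun t : ℝ => (t, (0 : ℝ), t ^ α)) '' Set.Ioo (0 : ℝ) 1)
      ((fun s : ℝ => (s, (0 : ℝ), s ^ ((α * e31 + c35) / c32))) '' Set.Ioo (0 : ℝ) 1) := by
  have hr : 0 < c32 / e31 := div_pos hc32 he31
  have key : ∀ t : ℝ, 0 < t → φ (t, 0, t ^ α) =
      (t ^ (c32 / e31), 0, (t ^ (c32 / e31)) ^ ((α * e31 + c35) / c32)) := by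
    intro t ht
    rw [hφ, zero_mul, ← Real.rpow_add ht, ← Real.rpow_mul ht.le]
    have h : α + c35 / e31 = c32 / e31 * ((α * e31 + c35) / c32) := by
      field_simp
    rw [h]
  refine ⟨?_, ?_, ?_⟩
  · rintro _ ⟨t, ht, rfl⟩
    exact ⟨t ^ (c32 / e31), ⟨Real.rpow_pos_of_pos ht.1 _,
      Real.rpow_lt_one ht.1.le ht.2 hr⟩, (key t ht.1).symm⟩
  · rintro _ ⟨t, ht, rfl⟩ _ ⟨u, hu, rfl⟩ h
    dsimp only at h
    rw [key t ht.1, key u hu.1] at h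
    have h1 : t ^ (c32 / e31) = u ^ (c32 / e31) := congrArg Prod.fst h
    have h2 : t = u := (Real.rpow_left_inj ht.1.le hu.1.le hr.ne').1 h1
    rw [h2]
  · rintro _ ⟨s, hs, rfl⟩
    have hp : 0 < s ^ (c32 / e31)⁻¹ := Real.rpow_pos_of_pos hs.1 _
    refine ⟨_, ⟨s ^ (c32 / e31)⁻¹, ⟨hp,
      Real.rpow_lt_one hs.1.le hs.2 (inv_pos.2 hr)⟩, rfl⟩, ?_⟩
    dsimp only
    rw [key _ hp, Real.rpow_inv_rpow hs.1.le hr.ne']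
end

section
/- Let ρ̃, ν̃, μ̃ be real numbers and let h(x,y,z) = (x^{ρ̃}, y·x^{ν̃}, z·x^{μ̃}) on (0,∞)×(0,∞)×(0,∞). Then for every n ∈ ℕ and all x₃, x₄, x₅ > 0, writing (X,Y,Z) = hⁿ(x₃,x₄,x₅), one has Y < X^{e24/e23} if and only if x₄ < x₃^{(e24/e23)·ρ̃ⁿ − ν̃·Σ_{i=0}^{n−1} ρ̃^i}, where e23, e24 > 0. (Characterization of the sets Ẽ_{n+1} of points taking at least n+1 turns around the R-cycle of the Bowtie network, used in the proof of Proposition 4.3.) -/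
/-- Characterization of the sets `Ẽ_{n+1}` of points taking at least `n+1` turns
around the R-cycle of the Bowtie network: writing `(X,Y,Z) = hⁿ(x₃,x₄,x₅)` for
the return map `h(x,y,z) = (x^{ρ̃}, y·x^{ν̃}, z·x^{μ̃})`, one has
`Y < X^{e24/e23}` iff `x₄ < x₃^{(e24/e23)·ρ̃ⁿ − ν̃·Σ_{i<n} ρ̃ⁱ}`. -/
theorem stmt_18 (ρt νt μt e23 e24 : ℝ) (he23 : 0 < e23) (he24 : 0 < e24)
    (h : ℝ × ℝ × ℝ → ℝ × ℝ × ℝ)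
    (hh : ∀ x y z : ℝ, h (x, y, z) = (x ^ ρt, y * x ^ νt, z * x ^ μt))
    (n : ℕ) (x3 x4 x5 : ℝ) (hx3 : 0 < x3) (hx4 : 0 < x4) (hx5 : 0 < x5) :
    (h^[n] (x3, x4, x5)).2.1 < (h^[n] (x3, x4, x5)).1 ^ (e24 / e23) ↔
      x4 < x3 ^ ((e24 / e23) * ρt ^ n - νt * ∑ i ∈ Finset.range n, ρt ^ i) := by
  induction n generalizing x3 x4 x5 with
  | zero => simp
  | succ n ih =>
    rw [Function.iterate_succ_apply, hh,
      ih _ _ _ (Real.rpow_pos_of_pos hx3 _) (mul_pos hx4 (Real.rpow_pos_of_pos hx3 _))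
        (mul_pos hx5 (Real.rpow_pos_of_pos hx3 _)),
      ← Real.rpow_mul hx3.le, ← lt_div_iff₀ (Real.rpow_pos_of_pos hx3 _),
      ← Real.rpow_sub hx3]
    have e : ρt * (e24 / e23 * ρt ^ n - νt * ∑ i ∈ Finset.range n, ρt ^ i) - νt
        = e24 / e23 * ρt ^ (n + 1) - νt * ∑ i ∈ Finset.range (n + 1), ρt ^ i := by
      have hs : ∑ i ∈ Finset.range (n + 1), ρt ^ i
          = ρt * ∑ i ∈ Finset.range n, ρt ^ i + 1 := by
        rw [Finset.sum_range_succ', Finset.mul_sum]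
        simp [pow_succ']
      rw [hs]
      ring
    rw [e]
end
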